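/- Let μ(t) = 1/(1+exp(−t)) be the sigmoid function, ℓ(t,y) = y·log μ(t) + (1−y)·log(1−μ(t)) the log-likelihood, and κ(L) = sup_{|t|≤L} 1/μ'(t). For any real number C > 1, any t, t* ∈ ℝ with |t − t*| ≤ C, and any y ∈ {0,1}, one has ℓ(t, y) ≥ ℓ(t*, y) + (y − μ(t*))·(t − t*) − (exp(C)/κ(|t*|))·(t − t*)². (Since μ' is even and decreasing in |t|, κ(|t*|) = 1/μ'(t*), so the coefficient equals exp(C)·μ'(t*).) -/

import Mathlib

/-- The sigmoid function μ(t) = 1/(1+exp(−t)). -/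
noncomputable def mu (t : ℝ) : ℝ := 1 / (1 + Real.exp (-t))

/-- Its derivative μ'(t) = μ(t)(1−μ(t)). -/
noncomputable def mu' (t : ℝ) : ℝ := mu t * (1 - mu t)

/-- The log-likelihood ℓ(t,y) = y·log μ(t) + (1−y)·log(1−μ(t)). -/
noncomputable def logLik (t y : ℝ) : ℝ :=
  y * Real.log (mu t) + (1 - y) * Real.log (1 - mu t)

/-- κ(L) = sup_{|t|≤L} 1/μ'(t). -/
noncomputable def kappa (L : ℝ) : ℝ := sSup ((fun t => 1 / mu' t) '' {t : ℝ | |t| ≤ L})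

theorem one_div_mu' (t : ℝ) : 1 / mu' t = 2 + 2 * Real.cosh t := by
  have h : Real.exp (-t) * Real.exp t = 1 := by rw [← Real.exp_add]; simp
  have hpos := Real.exp_pos (-t)
  unfold mu' mu
  rw [Real.cosh_eq]
  field_simp
  linear_combination -h

theorem kappa_abs (s : ℝ) : kappa |s| = 1 / mu' s := by
  refine IsGreatest.csSup_eq ⟨⟨s, le_refl |s|, rfl⟩, ?_⟩
  rintro _ ⟨t, ht, rfl⟩
  simp only [one_div_mu']
  have := Real.cosh_le_cosh.2 (show |t| ≤ |s| from ht)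
  linarith

theorem mu_pos (t : ℝ) : 0 < mu t := by
  unfold mu
  positivity

theorem one_sub_mu (t : ℝ) : 1 - mu t = mu (-t) := by
  have h : Real.exp (-t) * Real.exp t = 1 := by rw [← Real.exp_add]; simp
  have h1 := Real.exp_pos t
  have h2 := Real.exp_pos (-t)
  unfold mu
  rw [neg_neg]
  field_simp
  linear_combination h

theorem mu_lt_one (t : ℝ) : mu t < 1 := by
  linarith [one_sub_mu t, mu_pos (-t)]

theorem log_mu (t : ℝ) : Real.log (mu t) = -Real.log (1 + Real.exp (-t)) := by
  rw [mu, one_div, Real.log_inv]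

theorem log_one_add_exp_neg (t : ℝ) :
    Real.log (1 + Real.exp (-t)) = Real.log (1 + Real.exp t) - t := by
  have h : 1 + Real.exp (-t) = (1 + Real.exp t) / Real.exp t := by
    rw [Real.exp_neg]
    field_simp
    ring
  rw [h, Real.log_div (by positivity) (by positivity), Real.log_exp]

theorem logLik_eq (t y : ℝ) : logLik t y = y * t - Real.log (1 + Real.exp t) := by
  rw [logLik, one_sub_mu, log_mu, log_mu, neg_neg, log_one_add_exp_neg]
  ring

theorem log_one_add_exp_sub (s t : ℝ) :
    Real.log (1 + Real.exp t) - Real.log (1 + Real.exp s)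
      = Real.log (1 + mu s * (Real.exp (t - s) - 1)) := by
  rw [← Real.log_div (by positivity) (by positivity)]
  congr 1
  rw [mu, Real.exp_sub, Real.exp_neg]
  field_simp
  ring

/-- Second-order Taylor bound for the exponential. -/
theorem exp_sub_one_sub_self_le (d : ℝ) :
    Real.exp d - 1 - d ≤ d ^ 2 / 2 * Real.exp |d| := by
  rcases le_total 0 d with hd | hd
  · rw [abs_of_nonneg hd]
    have hder (x : ℝ) : HasDerivAt (fun x => Real.exp (-x) * (1 + x) + x ^ 2 / 2)
        (x * (1 - Real.exp (-x))) x := by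
      have h1 : HasDerivAt (fun x : ℝ => Real.exp (-x)) (Real.exp (-x) * (-1)) x :=
        (hasDerivAt_neg x).exp
      have h2 : HasDerivAt (fun x : ℝ => 1 + x) 1 x := (hasDerivAt_id x).const_add 1
      have h3 : HasDerivAt (fun x : ℝ => x ^ 2 / 2) x x := by
        simpa using (hasDerivAt_pow 2 x).div_const 2
      exact ((h1.mul h2).add h3).congr_deriv (by ring)
    have hmono : Monotone (fun x => Real.exp (-x) * (1 + x) + x ^ 2 / 2) := by
      refine monotone_of_hasDerivAt_nonneg hder fun x => ?_
      change 0 ≤ x * (1 - Real.exp (-x))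
      rcases le_total 0 x with hx | hx
      · exact mul_nonneg hx (by linarith [Real.exp_le_one_iff.2 (neg_nonpos.2 hx)])
      · exact mul_nonneg_of_nonpos_of_nonpos hx
          (by linarith [Real.one_le_exp (neg_nonneg.2 hx)])
    have h0 : 1 ≤ Real.exp (-d) * (1 + d) + d ^ 2 / 2 := by simpa using hmono hd
    have h : Real.exp d * Real.exp (-d) = 1 := by rw [← Real.exp_add]; simp
    linear_combination Real.exp d * h0 + (1 + d) * h
  · have hq := Real.quadratic_le_exp_of_nonneg (neg_nonneg.2 hd)
    have h : Real.exp d * Real.exp (-d) = 1 := by rw [← Real.exp_add]; simp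
    have hle : Real.exp d ≤ 1 + d + d ^ 2 / 2 := by
      nlinarith [mul_le_mul_of_nonneg_left hq (Real.exp_pos d).le, sq_nonneg (d ^ 2),
        sq_nonneg (1 - d)]
    nlinarith [mul_le_mul_of_nonneg_left (Real.one_le_exp (abs_nonneg d))
      (by positivity : 0 ≤ d ^ 2 / 2)]

theorem log_bernoulli_mgf_le_of_le_half {p : ℝ} (d : ℝ) (hp : 0 < p) (hp2 : p ≤ 1 / 2) :
    Real.log (1 + p * (Real.exp d - 1)) - p * d ≤ p * (1 - p) * Real.exp |d| * d ^ 2 := by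
  have hlog : Real.log (1 + p * (Real.exp d - 1)) ≤ p * (Real.exp d - 1) := by
    have := Real.log_le_sub_one_of_pos
      (show 0 < 1 + p * (Real.exp d - 1) by nlinarith [mul_pos hp (Real.exp_pos d)])
    linarith
  have h1 := mul_le_mul_of_nonneg_left (exp_sub_one_sub_self_le d) hp.le
  have h2 : 0 ≤ p * (1 / 2 - p) * (Real.exp |d| * d ^ 2) :=
    mul_nonneg (mul_nonneg hp.le (by linarith)) (by positivity)
  linear_combination hlog + h1 + h2

/-- Quadratic bound for the centred cumulant generating function of a Bernoulli variable. -/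
theorem log_bernoulli_mgf_le {p : ℝ} (d : ℝ) (hp : 0 < p) (hp1 : p < 1) :
    Real.log (1 + p * (Real.exp d - 1)) - p * d ≤ p * (1 - p) * Real.exp |d| * d ^ 2 := by
  rcases le_total p (1 / 2) with h | h
  · exact log_bernoulli_mgf_le_of_le_half d hp h
  · have key := log_bernoulli_mgf_le_of_le_half (p := 1 - p) (-d) (by linarith) (by linarith)
    have hpos : 0 < 1 + p * (Real.exp d - 1) := by nlinarith [mul_pos hp (Real.exp_pos d)]
    have hfac : 1 + (1 - p) * (Real.exp (-d) - 1)
        = (1 + p * (Real.exp d - 1)) / Real.exp d := by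
      rw [Real.exp_neg]
      field_simp
      ring
    rw [hfac, Real.log_div hpos.ne' (Real.exp_pos d).ne', Real.log_exp, abs_neg] at key
    linear_combination key

/-- Quadratic lower approximation of the log-likelihood. -/
theorem logLik_quadratic_lower_bound (C t tstar y : ℝ)
    (hC : 1 < C) (h : |t - tstar| ≤ C) (hy : y = 0 ∨ y = 1) :
    logLik tstar y + (y - mu tstar) * (t - tstar)
      - (Real.exp C / kappa |tstar|) * (t - tstar) ^ 2 ≤ logLik t y := by
  rw [kappa_abs, div_div_eq_mul_div, div_one, mu', logLik_eq, logLik_eq]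
  have hmgf := log_bernoulli_mgf_le (t - tstar) (mu_pos tstar) (mu_lt_one tstar)
  rw [← log_one_add_exp_sub] at hmgf
  have hexp := mul_le_mul_of_nonneg_left (Real.exp_le_exp.2 h)
    (mul_nonneg (mul_nonneg (mu_pos tstar).le (sub_nonneg.2 (mu_lt_one tstar).le))
      (sq_nonneg (t - tstar)))
  linear_combination hmgf + hexp
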